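/- arXiv:math/9604207 — 4 statements merged into one kernel-verified Lean document; each statement's English description precedes it below -/
import Mathlib

section
/- Let ι be a type of propositional variables, let s t : Set ι, and let f g : (ι → Bool) → Bool be Boolean-valued functions on valuations such that f depends only on the variables in s, g depends only on the variables in t, and f semantically entails g (i.e., for every valuation v : ι → Bool, f v = true implies g v = true). Then there exists an interpolant h : (ι → Bool) → Bool that depends only on the variables in s ∩ t and satisfies: for every valuation v : ι → Bool, f v = true implies h v = true, and h v = true implies g v = true. (This is the semantic form of the Craig Interpolation Theorem for classical propositional logic LK: if A → B is provable, there is a formula I in the language common to A and B with A → I and I → B provable.) -/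
/-- **Craig Interpolation Theorem for classical propositional logic (semantic form).**
If `f` depends only on the variables in `s`, `g` depends only on the variables in `t`,
and `f` semantically entails `g`, then there is an interpolant `h` depending only on
the variables in `s ∩ t` with `f` entailing `h` and `h` entailing `g`. -/
theorem propositional_craig_interpolation {ι : Type*} (s t : Set ι)
    (f g : (ι → Bool) → Bool)
    (hf : ∀ v w : ι → Bool, (∀ i ∈ s, v i = w i) → f v = f w)
    (hg : ∀ v w : ι → Bool, (∀ i ∈ t, v i = w i) → g v = g w)
    (hfg : ∀ v : ι → Bool, f v = true → g v = true) :
    ∃ h : (ι → Bool) → Bool,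
      (∀ v w : ι → Bool, (∀ i ∈ s ∩ t, v i = w i) → h v = h w) ∧
      (∀ v : ι → Bool, f v = true → h v = true) ∧
      (∀ v : ι → Bool, h v = true → g v = true) := by
  classical
  refine ⟨fun v => decide (∃ u : ι → Bool, (∀ i ∈ s ∩ t, u i = v i) ∧ f u = true), ?_, ?_, ?_⟩
  · intro v w hvw
    refine decide_eq_decide.mpr (exists_congr fun u => and_congr_left fun _ => ?_)
    exact forall₂_congr fun i hi => by rw [hvw i hi]
  · intro v hv
    exact decide_eq_true ⟨v, fun _ _ => rfl, hv⟩
  · intro v hv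
    obtain ⟨u, huv, hu⟩ := of_decide_eq_true hv
    have hfu : f (s.piecewise u v) = f u :=
      hf _ _ fun i hi => Set.piecewise_eq_of_mem s u v hi
    have hgv : g (s.piecewise u v) = g v := by
      refine hg _ _ fun i hi => ?_
      by_cases his : i ∈ s
      · rw [Set.piecewise_eq_of_mem s u v his, huv i ⟨his, hi⟩]
      · exact Set.piecewise_eq_of_notMem s u v his
    exact hgv ▸ hfg _ (hfu.trans hu)
end

section
/- Let ι be a type of propositional variables, let s t : Set ι, and let f g : (ι → Bool) → Bool be such that f depends only on the variables in s, g depends only on the variables in t, and f semantically entails g. Define h : (ι → Bool) → Bool by h v = true if and only if there exists a valuation w : ι → Bool with w i = v i for all i ∈ s ∩ t and f w = true. Then h depends only on the variables in s ∩ t, f semantically entails h, and h semantically entails g. (This exhibits an explicit strongest interpolant for classical propositional entailment.) -/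
/-- **Explicit strongest interpolant for classical propositional entailment.**
If `f` depends only on the variables in `s`, `g` depends only on the variables in `t`,
`f` semantically entails `g`, and `h` is defined by: `h v = true` iff there is a
valuation `w` agreeing with `v` on `s ∩ t` with `f w = true`, then `h` depends only
on the variables in `s ∩ t`, `f` entails `h`, and `h` entails `g`. -/
theorem propositional_strongest_interpolant {ι : Type*} (s t : Set ι)
    (f g h : (ι → Bool) → Bool)
    (hf : ∀ v w : ι → Bool, (∀ i ∈ s, v i = w i) → f v = f w)
    (hg : ∀ v w : ι → Bool, (∀ i ∈ t, v i = w i) → g v = g w)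
    (hfg : ∀ v : ι → Bool, f v = true → g v = true)
    (hdef : ∀ v : ι → Bool,
      h v = true ↔ ∃ w : ι → Bool, (∀ i ∈ s ∩ t, w i = v i) ∧ f w = true) :
    (∀ v w : ι → Bool, (∀ i ∈ s ∩ t, v i = w i) → h v = h w) ∧
    (∀ v : ι → Bool, f v = true → h v = true) ∧
    (∀ v : ι → Bool, h v = true → g v = true) := by
  classical
  refine ⟨fun v w hvw => ?_, fun v hv => (hdef v).2 ⟨v, fun _ _ => rfl, hv⟩, fun v hv => ?_⟩
  · rw [Bool.eq_iff_iff, hdef, hdef]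
    constructor
    · rintro ⟨u, hu, hfu⟩
      exact ⟨u, fun i hi => (hu i hi).trans (hvw i hi), hfu⟩
    · rintro ⟨u, hu, hfu⟩
      exact ⟨u, fun i hi => (hu i hi).trans (hvw i hi).symm, hfu⟩
  · obtain ⟨w, hw, hfw⟩ := (hdef v).1 hv
    have hgv : g (t.piecewise v w) = g v :=
      hg _ _ fun i hi => Set.piecewise_eq_of_mem _ _ _ hi
    have hfu : f (t.piecewise v w) = f w := hf _ _ fun i hi => by
      by_cases hit : i ∈ t
      · rw [Set.piecewise_eq_of_mem _ _ _ hit, hw i ⟨hi, hit⟩]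
      · exact Set.piecewise_eq_of_notMem _ _ _ hit
    rw [← hgv]
    exact hfg _ (hfu.trans hfw)
end

section
/- Let ι be a type of propositional variables, let s t : Set ι, and let f g : (ι → Bool) → Bool be such that f depends only on the variables in s, g depends only on the variables in t, and f semantically entails g. Define h : (ι → Bool) → Bool by h v = true if and only if for every valuation w : ι → Bool with w i = v i for all i ∈ s ∩ t one has g w = true. Then h depends only on the variables in s ∩ t, f semantically entails h, and h semantically entails g. (This exhibits an explicit weakest interpolant for classical propositional entailment.) -/
/-- **Explicit weakest interpolant for classical propositional entailment.**
If `f` depends only on the variables in `s`, `g` depends only on the variables in `t`,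
`f` semantically entails `g`, and `h` is defined by: `h v = true` iff every
valuation `w` agreeing with `v` on `s ∩ t` satisfies `g w = true`, then `h` depends
only on the variables in `s ∩ t`, `f` entails `h`, and `h` entails `g`. -/
theorem propositional_weakest_interpolant {ι : Type*} (s t : Set ι)
    (f g h : (ι → Bool) → Bool)
    (hf : ∀ v w : ι → Bool, (∀ i ∈ s, v i = w i) → f v = f w)
    (hg : ∀ v w : ι → Bool, (∀ i ∈ t, v i = w i) → g v = g w)
    (hfg : ∀ v : ι → Bool, f v = true → g v = true)
    (hdef : ∀ v : ι → Bool,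
      h v = true ↔ ∀ w : ι → Bool, (∀ i ∈ s ∩ t, w i = v i) → g w = true) :
    (∀ v w : ι → Bool, (∀ i ∈ s ∩ t, v i = w i) → h v = h w) ∧
    (∀ v : ι → Bool, f v = true → h v = true) ∧
    (∀ v : ι → Bool, h v = true → g v = true) := by
  classical
  refine ⟨fun v w hvw => ?_, fun v hv => ?_, fun v hv => ?_⟩
  · rw [Bool.eq_iff_iff, hdef, hdef]
    exact ⟨fun H u hu => H u fun i hi => (hu i hi).trans (hvw i hi).symm,
      fun H u hu => H u fun i hi => (hu i hi).trans (hvw i hi)⟩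
  · refine (hdef v).2 fun w hw => ?_
    have hu_s : ∀ i ∈ s, s.piecewise v w i = v i := fun i hi => by simp [hi]
    have hu_t : ∀ i ∈ t, s.piecewise v w i = w i := fun i hi => by
      by_cases his : i ∈ s
      · rw [hu_s i his, hw i ⟨his, hi⟩]
      · simp [his]
    rw [← hg _ _ hu_t]
    exact hfg _ ((hf _ _ hu_s).trans hv)
  · exact (hdef v).1 hv v fun _ _ => rfl
end

section
/- Craig Interpolation Theorem for classical first-order logic: Let L₀, La, Lb be first-order languages, let L := L₀.sum (La.sum Lb) be their disjoint union, and let i₀ : L₀ → L, i₁ : L₀.sum La → L, i₂ : L₀.sum Lb → L be the canonical language inclusions. Let A be a sentence of the language L₀.sum La and B a sentence of the language L₀.sum Lb, and suppose that every nonempty L-structure M satisfying the translation of A under i₁ also satisfies the translation of B under i₂. Then there exists an interpolant sentence I of the common language L₀ such that every nonempty L-structure satisfying the translation of A under i₁ satisfies the translation of I under i₀, and every nonempty L-structure satisfying the translation of I under i₀ satisfies the translation of B under i₂. -/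
open FirstOrder FirstOrder.Language

namespace FirstOrder.Language.Interpolation

/-- The formula `φ` only depends on the values of the variables in `T`. -/
def SupportedOn {L : Language.{0, 0}} {α : Type} (φ : L.Formula α) (T : Finset α) : Prop :=
  ∀ (M : Type) [L.Structure M] (v w : α → M), (∀ i ∈ T, v i = w i) →
    (φ.Realize v ↔ φ.Realize w)

theorem exists_supportedOn {L : Language.{0, 0}} {α : Type} (φ : L.Formula α) :
    ∃ T, SupportedOn φ T := by
  classical
  refine ⟨φ.freeVarFinset, fun M _ v w h => ?_⟩
  have hs : (φ.freeVarFinset : Set α) ⊆ φ.freeVarFinset := subset_rfl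
  rw [Formula.Realize, Formula.Realize, ← BoundedFormula.realize_restrictFreeVar' hs,
    ← BoundedFormula.realize_restrictFreeVar' hs (v := w)]
  exact iff_of_eq (congrArg (fun u => BoundedFormula.Realize _ u _) (funext fun i => h i i.2))

theorem SupportedOn.mono {L : Language.{0, 0}} {α : Type} {φ : L.Formula α} {T T' : Finset α}
    (h : SupportedOn φ T) (hT : T ⊆ T') : SupportedOn φ T' :=
  fun M _ v w hvw => h M v w fun i hi => hvw i (hT hi)

/-- Some structure and assignment realize all formulas in `S`. -/
def Sat {L : Language.{0, 0}} {α : Type} (S : Set (L.Formula α)) : Prop :=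
  ∃ (M : Type) (_ : L.Structure M) (_ : Nonempty M) (v : α → M), ∀ φ ∈ S, φ.Realize v

/-- Every assignment in a structure realizing `S` realizes `φ`. -/
def Entails {L : Language.{0, 0}} {α : Type} (S : Set (L.Formula α)) (φ : L.Formula α) : Prop :=
  ∀ (M : Type) [L.Structure M] [Nonempty M] (v : α → M), (∀ ψ ∈ S, ψ.Realize v) → φ.Realize v

theorem sat_of_finset {L : Language.{0, 0}} {α : Type} {S : Set (L.Formula α)}
    (h : ∀ T : Finset (L.Formula α), (T : Set (L.Formula α)) ⊆ S →
      Sat (T : Set (L.Formula α))) : Sat S := by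
  classical
  have hT : Theory.IsSatisfiable (Formula.equivSentence '' S : L[[α]].Theory) := by
    rw [Theory.isSatisfiable_iff_isFinitelySatisfiable]
    intro T₀ hT₀
    obtain ⟨M, _, _, v, hv⟩ := h (T₀.image Formula.equivSentence.symm) (by
      intro φ hφ
      simp only [Finset.coe_image, Set.mem_image, Finset.mem_coe] at hφ
      obtain ⟨σ, hσ, rfl⟩ := hφ
      obtain ⟨ψ, hψ, rfl⟩ := hT₀ hσ
      simpa using hψ)
    let := constantsOn.structure v
    have : M ⊨ (T₀ : L[[α]].Theory) := ⟨fun σ hσ => by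
      rw [← Formula.realize_equivSentence_symm]
      exact hv _ (Finset.mem_coe.2 (Finset.mem_image_of_mem _ hσ))⟩
    exact Theory.Model.isSatisfiable M
  obtain ⟨N⟩ := hT
  let : L.Structure N := (L.lhomWithConstants α).reduct N
  refine ⟨N, inferInstance, inferInstance, fun a => (L.con a : N), fun φ hφ => ?_⟩
  rw [← Formula.realize_equivSentence]
  exact N.is_model.realize_of_mem _ ⟨φ, hφ, rfl⟩

theorem sat_iUnion_union_image {L₀ L : Language.{0, 0}} {α : Type} (ι : L₀ →ᴸ L)
    {S : ℕ → Set (L.Formula α)} (hS : Monotone S) {Θ : Set (L₀.Formula α)}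
    (htop : ⊤ ∈ Θ) (hinf : ∀ θ₁ ∈ Θ, ∀ θ₂ ∈ Θ, θ₁ ⊓ θ₂ ∈ Θ)
    (h : ∀ n, ∀ θ ∈ Θ, ¬ Entails (S n) (ι.onFormula θ).not) :
    Sat ((⋃ n, S n) ∪ ι.onFormula '' Θ) := by
  classical
  refine sat_of_finset fun T hT => ?_
  have key : ∃ n, ∃ θ ∈ Θ, ∀ φ ∈ T, φ ∈ S n ∨
      ∀ (M : Type) [L.Structure M] (v : α → M), (ι.onFormula θ).Realize v → φ.Realize v := by
    induction T using Finset.induction_on with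
    | empty => exact ⟨0, ⊤, htop, by simp⟩
    | insert φ T _ ih =>
      obtain ⟨n, θ, hθ, hT'⟩ := ih fun x hx => hT (by simp [Finset.mem_coe.1 hx])
      rcases hT (Finset.mem_coe.2 (Finset.mem_insert_self φ T)) with hφ | ⟨θ', hθ', rfl⟩
      · obtain ⟨m, hm⟩ := Set.mem_iUnion.1 hφ
        refine ⟨max n m, θ, hθ, fun ψ hψ => ?_⟩
        rcases Finset.mem_insert.1 hψ with rfl | hψ
        · exact .inl (hS (le_max_right _ _) hm)
        · exact (hT' ψ hψ).imp_left fun h => hS (le_max_left _ _) h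
      · have hr : ∀ (M : Type) [L.Structure M] (v : α → M),
            (ι.onFormula (θ ⊓ θ')).Realize v →
              (ι.onFormula θ).Realize v ∧ (ι.onFormula θ').Realize v := by
          intro M _ v hv
          let := ι.reduct M
          simpa only [LHom.realize_onFormula, Formula.realize_inf] using hv
        refine ⟨n, θ ⊓ θ', hinf _ hθ _ hθ', fun ψ hψ => ?_⟩
        rcases Finset.mem_insert.1 hψ with rfl | hψ
        · exact .inr fun M _ v hv => (hr M v hv).2
        · exact (hT' ψ hψ).imp_right fun h M _ v hv => h M v (hr M v hv).1
  obtain ⟨n, θ, hθ, hT'⟩ := key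
  have := h n θ hθ
  simp only [Entails, not_forall, Formula.realize_not, not_not] at this
  obtain ⟨M, i₁, i₂, v, hv, hθv⟩ := this
  exact ⟨M, i₁, i₂, v, fun φ hφ => (hT' φ hφ).elim (hv φ) fun h => h M v hθv⟩

/-- No formula of `L₀` separates `S₁` from `S₂`. -/
def Insep {L₀ L₁ L₂ : Language.{0, 0}} {α : Type} (ι₁ : L₀ →ᴸ L₁) (ι₂ : L₀ →ᴸ L₂)
    (S₁ : Set (L₁.Formula α)) (S₂ : Set (L₂.Formula α)) : Prop :=
  ∀ θ : L₀.Formula α, ¬ (Entails S₁ (ι₁.onFormula θ) ∧ Entails S₂ (ι₂.onFormula θ).not)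

theorem Insep.symm {L₀ L₁ L₂ : Language.{0, 0}} {α : Type} {ι₁ : L₀ →ᴸ L₁} {ι₂ : L₀ →ᴸ L₂}
    {S₁ : Set (L₁.Formula α)} {S₂ : Set (L₂.Formula α)} (h : Insep ι₁ ι₂ S₁ S₂) :
    Insep ι₂ ι₁ S₂ S₁ := by
  rintro θ ⟨h₂, h₁⟩
  refine h θ.not ⟨fun M _ _ v hv => ?_, fun M _ _ v hv => ?_⟩
  · let := ι₁.reduct M
    simpa only [LHom.realize_onFormula, Formula.realize_not] using h₁ M v hv
  · let := ι₂.reduct M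
    simpa only [LHom.realize_onFormula, Formula.realize_not, not_not] using h₂ M v hv

/-- The variable `c` witnesses `∃ x, ψ x`, where `x` is the variable `Sum.inr ()` of `ψ`. -/
noncomputable def henkin {L : Language.{0, 0}} {α : Type} (ψ : L.Formula (α ⊕ Unit)) (c : α) :
    L.Formula α :=
  (ψ.iExs Unit).imp (ψ.relabel (Sum.elim id fun _ => c))

theorem realize_henkin {L : Language.{0, 0}} {α : Type} {ψ : L.Formula (α ⊕ Unit)} {c : α}
    {M : Type} [L.Structure M] {v : α → M} : (henkin ψ c).Realize v ↔
      ((∃ a, ψ.Realize (Sum.elim v fun _ => a)) → ψ.Realize (Sum.elim v fun _ => v c)) := by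
  have h : v ∘ Sum.elim id (fun _ : Unit => c) = Sum.elim v fun _ => v c := by
    funext i; cases i <;> rfl
  rw [henkin, Formula.realize_imp, Formula.realize_iExs, Formula.realize_relabel, h]
  exact imp_congr_left ⟨fun ⟨i, hi⟩ => ⟨i (), hi⟩, fun ⟨a, ha⟩ => ⟨_, ha⟩⟩

theorem Insep.insert_henkin {L₀ L₁ L₂ : Language.{0, 0}} {α : Type} {ι₁ : L₀ →ᴸ L₁}
    {ι₂ : L₀ →ᴸ L₂} {S₁ : Set (L₁.Formula α)} {S₂ : Set (L₂.Formula α)}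
    (h : Insep ι₁ ι₂ S₁ S₂) {T : Finset α} {ψ : L₁.Formula (α ⊕ Unit)} {U : Finset (α ⊕ Unit)}
    {c : α} (h₁ : ∀ φ ∈ S₁, SupportedOn φ T) (h₂ : ∀ φ ∈ S₂, SupportedOn φ T)
    (hψ : SupportedOn ψ U) (hcT : c ∉ T) (hcU : Sum.inl c ∉ U) :
    Insep ι₁ ι₂ (insert (henkin ψ c) S₁) S₂ := by
  classical
  rintro θ ⟨hθ₁, hθ₂⟩
  have hex : ∀ {M : Type} [L₀.Structure M] (v : α → M),
      ((θ.relabel fun i => if i = c then Sum.inr () else Sum.inl i).iExs Unit).Realize v ↔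
        ∃ a, θ.Realize (Function.update v c a) := by
    intro M _ v
    have hc : ∀ x : Unit → M, Sum.elim v x ∘ (fun i => if i = c then Sum.inr () else Sum.inl i) =
        Function.update v c (x ()) := by
      intro x
      funext i
      by_cases hi : i = c
      · subst hi; simp
      · simp [hi]
    simp only [Formula.realize_iExs, Formula.realize_relabel, hc]
    exact ⟨fun ⟨i, hi⟩ => ⟨i (), hi⟩, fun ⟨a, ha⟩ => ⟨fun _ => a, ha⟩⟩
  have hupd : ∀ {M : Type} (v : α → M) (a : M), ∀ i ∈ T, v i = Function.update v c a i :=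
    fun v a i hi => (Function.update_of_ne (ne_of_mem_of_not_mem hi hcT) _ _).symm
  refine h ((θ.relabel fun i => if i = c then Sum.inr () else Sum.inl i).iExs Unit)
    ⟨fun M _ _ v hv => ?_, fun M _ _ v hv => ?_⟩
  · let := ι₁.reduct M
    rw [LHom.realize_onFormula, hex]
    obtain ⟨a, ha⟩ : ∃ a, (∃ b, ψ.Realize (Sum.elim v fun _ => b)) →
        ψ.Realize (Sum.elim v fun _ => a) := by
      by_cases hb : ∃ b, ψ.Realize (Sum.elim v fun _ => b)
      · exact hb.imp fun _ h _ => h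
      · exact ⟨Classical.arbitrary M, fun h => (hb h).elim⟩
    have hψa : ∀ b, ψ.Realize (Sum.elim v fun _ => b) ↔
        ψ.Realize (Sum.elim (Function.update v c a) fun _ => b) := fun b => hψ M _ _ (by
      rintro (i | i) hi
      · exact (Function.update_of_ne (fun h : i = c => hcU (h ▸ hi)) _ _).symm
      · rfl)
    refine ⟨a, (LHom.realize_onFormula ι₁ θ).1 (hθ₁ M _ ?_)⟩
    rintro φ (rfl | hφ)
    · rw [realize_henkin, Function.update_self, ← hψa]
      simpa only [← hψa] using ha
    · exact (h₁ φ hφ M _ _ (hupd v a)).1 (hv φ hφ)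
  · let := ι₂.reduct M
    rw [Formula.realize_not, LHom.realize_onFormula, hex]
    rintro ⟨a, ha⟩
    exact hθ₂ M (Function.update v c a) (fun φ hφ => (h₂ φ hφ M _ _ (hupd v a)).1 (hv φ hφ))
      ((LHom.realize_onFormula ι₂ θ).2 ha)

/-- An inseparable pair of sets of formulas, each involving only finitely many variables. -/
def Good {L₀ L₁ L₂ : Language.{0, 0}} (ι₁ : L₀ →ᴸ L₁) (ι₂ : L₀ →ᴸ L₂)
    (p : Set (L₁.Formula ℕ) × Set (L₂.Formula ℕ)) : Prop :=
  Insep ι₁ ι₂ p.1 p.2 ∧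
    ∃ T : Finset ℕ, (∀ φ ∈ p.1, SupportedOn φ T) ∧ ∀ φ ∈ p.2, SupportedOn φ T

theorem Good.symm {L₀ L₁ L₂ : Language.{0, 0}} {ι₁ : L₀ →ᴸ L₁} {ι₂ : L₀ →ᴸ L₂}
    {p : Set (L₁.Formula ℕ) × Set (L₂.Formula ℕ)} (h : Good ι₁ ι₂ p) : Good ι₂ ι₁ p.swap :=
  ⟨h.1.symm, h.2.imp fun _ => And.symm⟩

theorem Good.exists_henkin_left {L₀ L₁ L₂ : Language.{0, 0}} {ι₁ : L₀ →ᴸ L₁} {ι₂ : L₀ →ᴸ L₂}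
    {p : Set (L₁.Formula ℕ) × Set (L₂.Formula ℕ)} (h : Good ι₁ ι₂ p)
    (ψ : L₁.Formula (ℕ ⊕ Unit)) : ∃ q, Good ι₁ ι₂ q ∧ p ≤ q ∧ ∃ c, henkin ψ c ∈ q.1 := by
  classical
  obtain ⟨hp, T, h₁, h₂⟩ := h
  obtain ⟨U, hU⟩ := exists_supportedOn ψ
  obtain ⟨c, hc⟩ := Infinite.exists_notMem_finset (T ∪ U.preimage Sum.inl Sum.inl_injective.injOn)
  simp only [Finset.mem_union, Finset.mem_preimage, not_or] at hc
  obtain ⟨V, hV⟩ := exists_supportedOn (henkin ψ c)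
  refine ⟨(insert (henkin ψ c) p.1, p.2), ⟨hp.insert_henkin h₁ h₂ hU hc.1 hc.2, T ∪ V, ?_, ?_⟩,
    ⟨Set.subset_insert _ _, le_rfl⟩, c, Set.mem_insert _ _⟩
  · rintro φ (rfl | hφ)
    · exact hV.mono Finset.subset_union_right
    · exact (h₁ φ hφ).mono Finset.subset_union_left
  · exact fun φ hφ => (h₂ φ hφ).mono Finset.subset_union_left

theorem Good.exists_henkin {L₀ L₁ L₂ : Language.{0, 0}} {ι₁ : L₀ →ᴸ L₁} {ι₂ : L₀ →ᴸ L₂}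
    {p : Set (L₁.Formula ℕ) × Set (L₂.Formula ℕ)} (h : Good ι₁ ι₂ p)
    (ψ₁ : L₁.Formula (ℕ ⊕ Unit)) (ψ₂ : L₂.Formula (ℕ ⊕ Unit)) :
    ∃ q, Good ι₁ ι₂ q ∧ p ≤ q ∧ (∃ c, henkin ψ₁ c ∈ q.1) ∧ ∃ c, henkin ψ₂ c ∈ q.2 := by
  obtain ⟨q, hq, hpq, c, hc⟩ := h.exists_henkin_left ψ₁
  obtain ⟨r, hr, hqr, d, hd⟩ := hq.symm.exists_henkin_left ψ₂
  have hqr' : q ≤ r.swap := ⟨hqr.2, hqr.1⟩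
  exact ⟨r.swap, hr.symm, hpq.trans hqr', ⟨c, hqr'.1 hc⟩, d, hd⟩

/-- Inseparable sets over countable languages extend to increasing sequences of inseparable sets
whose unions contain a Henkin witness for every existential formula. -/
theorem Good.exists_seq {L₀ L₁ L₂ : Language.{0, 0}} [Countable L₁.Symbols] [Countable L₂.Symbols]
    {ι₁ : L₀ →ᴸ L₁} {ι₂ : L₀ →ᴸ L₂} {p : Set (L₁.Formula ℕ) × Set (L₂.Formula ℕ)}
    (h : Good ι₁ ι₂ p) : ∃ f : ℕ → Set (L₁.Formula ℕ) × Set (L₂.Formula ℕ),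
      Monotone f ∧ f 0 = p ∧ (∀ n, Insep ι₁ ι₂ (f n).1 (f n).2) ∧
      (∀ ψ, ∃ n c, henkin ψ c ∈ (f n).1) ∧ ∀ ψ, ∃ n c, henkin ψ c ∈ (f n).2 := by
  have : Nonempty (L₁.Formula (ℕ ⊕ Unit)) := ⟨⊤⟩
  have : Nonempty (L₂.Formula (ℕ ⊕ Unit)) := ⟨⊤⟩
  obtain ⟨e₁, he₁⟩ := exists_surjective_nat (L₁.Formula (ℕ ⊕ Unit))
  obtain ⟨e₂, he₂⟩ := exists_surjective_nat (L₂.Formula (ℕ ⊕ Unit))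
  choose next hgood hle hw₁ hw₂ using
    fun (n : ℕ) (q : {q // Good ι₁ ι₂ q}) => q.2.exists_henkin (e₁ n) (e₂ n)
  let F : ℕ → {q // Good ι₁ ι₂ q} := fun n => Nat.rec ⟨p, h⟩ (fun n q => ⟨next n q, hgood n q⟩) n
  refine ⟨fun n => (F n).1, monotone_nat_of_le_succ fun n => hle n (F n), rfl, fun n => (F n).2.1,
    fun ψ => ?_, fun ψ => ?_⟩
  · obtain ⟨n, rfl⟩ := he₁ ψ
    exact ⟨n + 1, hw₁ n (F n)⟩
  · obtain ⟨n, rfl⟩ := he₂ ψ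
    exact ⟨n + 1, hw₂ n (F n)⟩

/-- The two sides of an inseparable pair have models with the same `L₀`-theory, in which every true
existential formula is witnessed by a variable. -/
theorem Good.exists_models {L₀ L₁ L₂ : Language.{0, 0}} [Countable L₁.Symbols]
    [Countable L₂.Symbols] {ι₁ : L₀ →ᴸ L₁} {ι₂ : L₀ →ᴸ L₂}
    {p : Set (L₁.Formula ℕ) × Set (L₂.Formula ℕ)} (h : Good ι₁ ι₂ p) :
    ∃ (M N : Type) (_ : L₁.Structure M) (_ : L₂.Structure N) (v : ℕ → M) (w : ℕ → N),
      (∀ φ ∈ p.1, φ.Realize v) ∧ (∀ φ ∈ p.2, φ.Realize w) ∧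
      (∀ ψ, ∃ c, (henkin (L := L₁) ψ c).Realize v) ∧
      (∀ ψ, ∃ c, (henkin (L := L₂) ψ c).Realize w) ∧
      ∀ θ : L₀.Formula ℕ, (ι₁.onFormula θ).Realize v ↔ (ι₂.onFormula θ).Realize w := by
  obtain ⟨f, hf, rfl, hins, hw₁, hw₂⟩ := h.exists_seq
  obtain ⟨N, _, _, w, hw⟩ := sat_iUnion_union_image ι₂ (S := fun n => (f n).2)
    (fun m n hmn => (hf hmn).2) (Θ := {θ | ∃ n, Entails (f n).1 (ι₁.onFormula θ)})
    ⟨0, fun M _ _ v _ => by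
      let := ι₁.reduct M
      simp [LHom.realize_onFormula]⟩
    (by
      rintro θ₁ ⟨m, hm⟩ θ₂ ⟨n, hn⟩
      refine ⟨max m n, fun M _ _ v hv => ?_⟩
      have h₁ := hm M v fun ψ hψ => hv ψ ((hf (le_max_left m n)).1 hψ)
      have h₂ := hn M v fun ψ hψ => hv ψ ((hf (le_max_right m n)).1 hψ)
      let := ι₁.reduct M
      rw [LHom.realize_onFormula] at h₁ h₂ ⊢
      exact Formula.realize_inf.2 ⟨h₁, h₂⟩)
    (by
      rintro n θ ⟨m, hm⟩ hn
      refine hins (max m n) θ ⟨fun M _ _ v hv => ?_, fun M _ _ v hv => ?_⟩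
      · exact hm M v fun ψ hψ => hv ψ ((hf (le_max_left m n)).1 hψ)
      · exact hn M v fun ψ hψ => hv ψ ((hf (le_max_right m n)).2 hψ))
  obtain ⟨M, _, _, v, hv⟩ := sat_iUnion_union_image ι₁ (S := fun n => (f n).1)
    (fun m n hmn => (hf hmn).1) (Θ := {θ | (ι₂.onFormula θ).Realize w})
    (by
      let := ι₂.reduct N
      simp [LHom.realize_onFormula])
    (by
      let := ι₂.reduct N
      simp only [Set.mem_ofPred_eq, LHom.realize_onFormula, Formula.realize_inf]
      exact fun _ h₁ _ h₂ => ⟨h₁, h₂⟩)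
    (by
      intro n θ hθ hn
      have h_not : (ι₂.onFormula θ.not).Realize w := hw _ (.inr ⟨θ.not, ⟨n, hn⟩, rfl⟩)
      let := ι₂.reduct N
      rw [LHom.realize_onFormula, Formula.realize_not, ← LHom.realize_onFormula ι₂] at h_not
      exact h_not hθ)
  have hlift : ∀ {n φ}, φ ∈ (f n).1 → φ.Realize v :=
    fun {n φ} hφ => hv φ (.inl (Set.mem_iUnion.2 ⟨n, hφ⟩))
  have hlift' : ∀ {n φ}, φ ∈ (f n).2 → φ.Realize w :=
    fun {n φ} hφ => hw φ (.inl (Set.mem_iUnion.2 ⟨n, hφ⟩))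
  have himp : ∀ θ : L₀.Formula ℕ, (ι₂.onFormula θ).Realize w → (ι₁.onFormula θ).Realize v :=
    fun θ hθ => hv _ (.inr ⟨θ, hθ, rfl⟩)
  refine ⟨M, N, inferInstance, inferInstance, v, w, fun φ => hlift, fun φ => hlift',
    fun ψ => ?_, fun ψ => ?_, fun θ => ⟨fun hθ => ?_, himp θ⟩⟩
  · obtain ⟨n, c, hc⟩ := hw₁ ψ
    exact ⟨c, hlift hc⟩
  · obtain ⟨n, c, hc⟩ := hw₂ ψ
    exact ⟨c, hlift' hc⟩
  · by_contra hn
    have h_not : (ι₁.onFormula θ.not).Realize v := himp θ.not (by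
      let := ι₂.reduct N
      rwa [LHom.realize_onFormula, Formula.realize_not, ← LHom.realize_onFormula ι₂])
    let := ι₁.reduct M
    rw [LHom.realize_onFormula, Formula.realize_not, ← LHom.realize_onFormula ι₁] at h_not
    exact h_not hθ

/-- A map whose range contains Henkin witnesses underlies an elementary embedding. -/
theorem exists_elementaryEmbedding {L : Language.{0, 0}} {M Q : Type} [L.Structure M] (v : ℕ → M)
    (hv : ∀ ψ, ∃ c, (henkin (L := L) ψ c).Realize v) (p : ℕ → Q) (hp : p.Surjective) (j : Q → M)
    (hj : j.Injective) (hjp : ∀ c, j (p c) = v c) :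
    ∃ (_ : L.Structure Q) (e : Q ↪ₑ[L] M), ⇑e = j := by
  have hfun : ∀ {n} (f : L.Functions n) (x : Fin n → Q), ∃ b, j b = Structure.funMap f (j ∘ x) := by
    intro n f x
    choose k hk using fun i => hp (x i)
    obtain ⟨c, hc⟩ := hv ((Term.func f fun i => Term.var (Sum.inl (k i))).equal
      (Term.var (Sum.inr ())))
    have hx : j ∘ x = fun i => v (k i) := funext fun i => by simp [← hk, hjp]
    rw [realize_henkin] at hc
    simp only [Formula.realize_equal, Term.realize_func, Term.realize_var, Sum.elim_inl,
      Sum.elim_inr] at hc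
    exact ⟨p c, by rw [hjp, hx, ← hc ⟨_, rfl⟩]⟩
  let : L.Structure Q :=
    { funMap := fun f x => (hfun f x).choose
      RelMap := fun r x => Structure.RelMap r (j ∘ x) }
  let e₀ : Q ↪[L] M :=
    { toFun := j
      inj' := hj
      map_fun' := fun f x => (hfun f x).choose_spec
      map_rel' := fun _ _ => Iff.rfl }
  refine ⟨inferInstance, ⟨j, fun _ => e₀.isElementary_of_exists ?_⟩, rfl⟩
  intro n φ x a ha
  choose k hk using fun i => hp (x i)
  let g : Empty ⊕ Fin (n + 1) → ℕ ⊕ Unit :=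
    Sum.elim Empty.elim (Fin.snoc (α := fun _ => ℕ ⊕ Unit) (fun i => Sum.inl (k i)) (Sum.inr ()))
  have hg : ∀ b : M, (φ.toFormula.relabel g).Realize (Sum.elim v fun _ => b) ↔
      φ.Realize default (Fin.snoc (e₀ ∘ x) b : _ → M) := by
    intro b
    rw [Formula.realize_relabel, BoundedFormula.realize_toFormula]
    refine iff_of_eq (congrArg₂ _ (Subsingleton.elim _ _) (funext fun i => ?_))
    refine Fin.lastCases ?_ (fun i => ?_) i
    · simp [g]
    · simpa [g, ← hk] using (show e₀ (p (k i)) = v (k i) from hjp (k i)).symm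
  obtain ⟨c, hc⟩ := hv (φ.toFormula.relabel g)
  rw [realize_henkin] at hc
  refine ⟨p c, ?_⟩
  rw [← hg, show e₀ (p c) = v c from hjp c]
  exact hc ⟨a, (hg a).2 ha⟩

theorem realize_onFormula_equal {L₀ L : Language.{0, 0}} {α M : Type} [L.Structure M]
    (ι : L₀ →ᴸ L) (c d : α) (u : α → M) :
    (ι.onFormula ((Term.var c).equal (Term.var d))).Realize u ↔ u c = u d := by
  let := ι.reduct M
  rw [LHom.realize_onFormula, Formula.realize_equal, Term.realize_var, Term.realize_var]

theorem realize_onFormula_func {L₀ L : Language.{0, 0}} {α M : Type} [L.Structure M]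
    (ι : L₀ →ᴸ L) {n : ℕ} (f : L₀.Functions n) (k : Fin n → α) (c : α) (u : α → M) :
    (ι.onFormula ((Term.func f fun i => Term.var (k i)).equal (Term.var c))).Realize u ↔
      Structure.funMap (ι.onFunction f) (fun i => u (k i)) = u c := by
  let := ι.reduct M
  simp only [LHom.realize_onFormula, Formula.realize_equal, Term.realize_func, Term.realize_var,
    LHom.map_onFunction]

theorem realize_onFormula_rel {L₀ L : Language.{0, 0}} {α M : Type} [L.Structure M]
    (ι : L₀ →ᴸ L) {n : ℕ} (r : L₀.Relations n) (k : Fin n → α) (u : α → M) :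
    (ι.onFormula (r.formula fun i => Term.var (k i))).Realize u ↔
      Structure.RelMap (ι.onRelation r) (fun i => u (k i)) := by
  let := ι.reduct M
  simp only [LHom.realize_onFormula, Formula.realize_rel, Term.realize_var, LHom.map_onRelation]

/-- The two sides of an inseparable pair are realized in structures on the same type which agree on
the symbols of `L₀`. -/
theorem Good.exists_amalgam {L₀ L₁ L₂ : Language.{0, 0}} [Countable L₁.Symbols]
    [Countable L₂.Symbols] {ι₁ : L₀ →ᴸ L₁} {ι₂ : L₀ →ᴸ L₂}
    {p : Set (L₁.Formula ℕ) × Set (L₂.Formula ℕ)} (h : Good ι₁ ι₂ p) :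
    ∃ (Q : Type) (_ : L₁.Structure Q) (_ : L₂.Structure Q) (u : ℕ → Q),
      (∀ φ ∈ p.1, φ.Realize u) ∧ (∀ φ ∈ p.2, φ.Realize u) ∧
      (∀ {n} (f : L₀.Functions n) (x : Fin n → Q),
        Structure.funMap (ι₁.onFunction f) x = Structure.funMap (ι₂.onFunction f) x) ∧
      ∀ {n} (r : L₀.Relations n) (x : Fin n → Q),
        Structure.RelMap (ι₁.onRelation r) x ↔ Structure.RelMap (ι₂.onRelation r) x := by
  obtain ⟨M, N, _, _, v, w, hv, hw, hHv, hHw, hθ⟩ := h.exists_models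
  have hker : ∀ c d, v c = v d ↔ w c = w d := fun c d => by
    simpa only [realize_onFormula_equal] using hθ ((Term.var c).equal (Term.var d))
  let u : ℕ → Quotient (Setoid.ker v) := Quotient.mk _
  have hu : u.Surjective := Quotient.mk_surjective
  let j₁ : Quotient (Setoid.ker v) → M := Quotient.lift v fun _ _ h => h
  let j₂ : Quotient (Setoid.ker v) → N := Quotient.lift w fun _ _ h => (hker _ _).1 h
  obtain ⟨_, e₁, he₁⟩ := exists_elementaryEmbedding v hHv u hu j₁
    (by rintro ⟨c⟩ ⟨d⟩ h; exact Quotient.sound h) fun _ => rfl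
  obtain ⟨_, e₂, he₂⟩ := exists_elementaryEmbedding w hHw u hu j₂
    (by rintro ⟨c⟩ ⟨d⟩ h; exact Quotient.sound ((hker _ _).2 h)) fun _ => rfl
  have hv' : v = e₁ ∘ u := by rw [he₁]; rfl
  have hw' : w = e₂ ∘ u := by rw [he₂]; rfl
  have hθ' : ∀ θ : L₀.Formula ℕ, (ι₁.onFormula θ).Realize u ↔ (ι₂.onFormula θ).Realize u := by
    intro θ
    rw [← e₁.map_formula, ← e₂.map_formula, ← hv', ← hw', hθ]
  refine ⟨_, inferInstance, inferInstance, u, fun φ hφ => ?_, fun φ hφ => ?_, fun {n} f x => ?_,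
    fun {n} r x => ?_⟩
  · rw [← e₁.map_formula, ← hv']
    exact hv φ hφ
  · rw [← e₂.map_formula, ← hw']
    exact hw φ hφ
  · choose k hk using fun i => hu (x i)
    obtain ⟨c, hc⟩ := hu (Structure.funMap (ι₁.onFunction f) x)
    have := hθ' ((Term.func f fun i => Term.var (k i)).equal (Term.var c))
    simp only [realize_onFormula_func, hk, hc, true_iff] at this
    exact this.symm
  · choose k hk using fun i => hu (x i)
    simpa only [realize_onFormula_rel, hk] using hθ' (r.formula fun i => Term.var (k i))

theorem countable_symbols_sum {L L' : Language.{0, 0}} [Countable L.Symbols]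
    [Countable L'.Symbols] : Countable (L.sum L').Symbols := by
  rw [← Cardinal.mk_le_aleph0_iff]
  change (L.sum L').card ≤ _
  rw [card_sum, Cardinal.add_le_aleph0, Cardinal.lift_le_aleph0, Cardinal.lift_le_aleph0]
  exact ⟨Cardinal.mk_le_aleph0_iff.2 ‹_›, Cardinal.mk_le_aleph0_iff.2 ‹_›⟩

/-- Structures for `L₀.sum La` and `L₀.sum Lb` on the same type which agree on `L₀` have a common
expansion. -/
theorem exists_common_expansion {L₀ La Lb : Language.{0, 0}} {Q : Type} [(L₀.sum La).Structure Q]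
    [(L₀.sum Lb).Structure Q]
    (hf : ∀ {n} (f : L₀.Functions n) (x : Fin n → Q),
      Structure.funMap ((LHom.sumInl : L₀ →ᴸ L₀.sum La).onFunction f) x =
        Structure.funMap ((LHom.sumInl : L₀ →ᴸ L₀.sum Lb).onFunction f) x)
    (hr : ∀ {n} (r : L₀.Relations n) (x : Fin n → Q),
      Structure.RelMap ((LHom.sumInl : L₀ →ᴸ L₀.sum La).onRelation r) x ↔
        Structure.RelMap ((LHom.sumInl : L₀ →ᴸ L₀.sum Lb).onRelation r) x) :
    ∃ _ : (L₀.sum (La.sum Lb)).Structure Q,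
      ((LHom.id L₀).sumMap LHom.sumInl : L₀.sum La →ᴸ L₀.sum (La.sum Lb)).IsExpansionOn Q ∧
      ((LHom.id L₀).sumMap LHom.sumInr : L₀.sum Lb →ᴸ L₀.sum (La.sum Lb)).IsExpansionOn Q := by
  let := (LHom.sumInl : L₀ →ᴸ L₀.sum La).reduct Q
  let := (LHom.sumInr : La →ᴸ L₀.sum La).reduct Q
  let := (LHom.sumInr : Lb →ᴸ L₀.sum Lb).reduct Q
  refine ⟨inferInstance, ⟨?_, ?_⟩, ⟨?_, ?_⟩⟩
  · rintro n (f | f) x <;> rfl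
  · rintro n (f | f) x <;> rfl
  · rintro n (f | f) x
    · exact hf f x
    · rfl
  · rintro n (f | f) x
    · exact propext (hr f x)
    · rfl

/-- An entailment between `L₀.sum La` and `L₀.sum Lb` has an interpolant, for countable
languages. -/
theorem exists_interpolant_of_countable {L₀ La Lb : Language.{0, 0}} [Countable L₀.Symbols]
    [Countable La.Symbols] [Countable Lb.Symbols] (A : (L₀.sum La).Sentence)
    (B : (L₀.sum Lb).Sentence)
    (hAB : ∀ (M : Type) [(L₀.sum (La.sum Lb)).Structure M] [Nonempty M],
      M ⊨ ((LHom.id L₀).sumMap LHom.sumInl : L₀.sum La →ᴸ L₀.sum (La.sum Lb)).onSentence A →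
      M ⊨ ((LHom.id L₀).sumMap LHom.sumInr : L₀.sum Lb →ᴸ L₀.sum (La.sum Lb)).onSentence B) :
    ∃ I : L₀.Sentence,
      (∀ (M : Type) [(L₀.sum La).Structure M] [Nonempty M],
        M ⊨ A → M ⊨ (LHom.sumInl : L₀ →ᴸ L₀.sum La).onSentence I) ∧
      (∀ (M : Type) [(L₀.sum Lb).Structure M] [Nonempty M],
        M ⊨ (LHom.sumInl : L₀ →ᴸ L₀.sum Lb).onSentence I → M ⊨ B) := by
  have := countable_symbols_sum (L := L₀) (L' := La)
  have := countable_symbols_sum (L := L₀) (L' := Lb)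
  let φ : (L₀.sum La).Formula ℕ := Formula.relabel Empty.elim A
  let χ : (L₀.sum Lb).Formula ℕ := (Formula.relabel Empty.elim B).not
  have hφ : ∀ {M : Type} [(L₀.sum La).Structure M] (v : ℕ → M), φ.Realize v ↔ M ⊨ A := by
    intro M _ v
    rw [Formula.realize_relabel, Sentence.Realize, Subsingleton.elim (v ∘ Empty.elim) default]
  have hχ : ∀ {M : Type} [(L₀.sum Lb).Structure M] (v : ℕ → M), χ.Realize v ↔ ¬ M ⊨ B := by
    intro M _ v
    rw [Formula.realize_not, Formula.realize_relabel, Sentence.Realize,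
      Subsingleton.elim (v ∘ Empty.elim) default]
  by_contra hI
  have hgood : Good (LHom.sumInl : L₀ →ᴸ L₀.sum La) (LHom.sumInl : L₀ →ᴸ L₀.sum Lb)
      ({φ}, {χ}) := by
    classical
    refine ⟨?_, ?_⟩
    · rintro θ ⟨h₁, h₂⟩
      let I : L₀.Sentence :=
        Formula.iExs Unit (θ.relabel fun _ => (Sum.inr () : Empty ⊕ Unit))
      have hIr : ∀ {M : Type} [L₀.Structure M], M ⊨ I ↔ ∃ a : M, θ.Realize fun _ => a := by
        intro M _
        simp only [I, Sentence.Realize, Formula.realize_iExs, Formula.realize_relabel]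
        exact ⟨fun ⟨i, hi⟩ => ⟨i (), hi⟩, fun ⟨a, ha⟩ => ⟨fun _ => a, ha⟩⟩
      refine hI ⟨I, fun M _ _ hA => ?_, fun M _ _ hM => ?_⟩
      · let := (LHom.sumInl : L₀ →ᴸ L₀.sum La).reduct M
        rw [LHom.realize_onSentence, hIr]
        refine ⟨Classical.arbitrary M, ?_⟩
        rw [← LHom.realize_onFormula (LHom.sumInl : L₀ →ᴸ L₀.sum La)]
        refine h₁ M _ ?_
        rintro ψ rfl
        exact (hφ _).2 hA
      · let := (LHom.sumInl : L₀ →ᴸ L₀.sum Lb).reduct M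
        rw [LHom.realize_onSentence, hIr] at hM
        obtain ⟨a, ha⟩ := hM
        by_contra hB
        rw [← LHom.realize_onFormula (LHom.sumInl : L₀ →ᴸ L₀.sum Lb)] at ha
        refine h₂ M (fun _ => a) ?_ ha
        rintro ψ rfl
        exact (hχ _).2 hB
    · obtain ⟨T, hT⟩ := exists_supportedOn φ
      obtain ⟨U, hU⟩ := exists_supportedOn χ
      refine ⟨T ∪ U, ?_, ?_⟩
      · rintro ψ rfl
        exact hT.mono Finset.subset_union_left
      · rintro ψ rfl
        exact hU.mono Finset.subset_union_right
  obtain ⟨Q, _, _, u, h₁, h₂, hf, hr⟩ := hgood.exists_amalgam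
  obtain ⟨_, _, _⟩ := exists_common_expansion hf hr
  have : Nonempty Q := ⟨u 0⟩
  have hA := (hφ u).1 (h₁ φ rfl)
  refine (hχ u).1 (h₂ χ rfl) ?_
  have h := hAB Q
  rw [LHom.realize_onSentence, LHom.realize_onSentence] at h
  exact h hA

universe u₁ v₁ u₂ v₂ w

/-- Every term lies in the range of any language map which hits a certain countable set of
symbols. -/
theorem exists_countable_functions {L : Language.{u₁, v₁}} {α : Type w} (t : L.Term α) :
    ∃ F : ∀ n, Set (L.Functions n), (∀ n, (F n).Countable) ∧
      ∀ (K : Language.{0, 0}) (ι : K →ᴸ L),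
        (∀ n, F n ⊆ Set.range fun f : K.Functions n => ι.onFunction f) →
        ∃ s : K.Term α, ι.onTerm s = t := by
  induction t with
  | var a => exact ⟨fun _ => ∅, fun _ => Set.countable_empty, fun K ι _ => ⟨Term.var a, rfl⟩⟩
  | @func l f ts ih =>
    choose F hF hι using ih
    refine ⟨fun n => (⋃ i, F i n) ∪ {g | (⟨n, g⟩ : Σ n, L.Functions n) = ⟨l, f⟩}, fun n => ?_,
      fun K ι h => ?_⟩
    · refine (Set.countable_iUnion fun i => hF i n).union (Set.Subsingleton.countable ?_)
      intro g hg g' hg'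
      exact eq_of_heq (Sigma.mk.inj (Eq.trans hg (Eq.symm hg'))).2
    · choose s hs using fun i => hι i K ι fun n =>
        (Set.subset_iUnion (fun i => F i n) i).trans (Set.subset_union_left.trans (h n))
      obtain ⟨g, hg⟩ := h l (.inr rfl)
      refine ⟨Term.func g s, ?_⟩
      simp only [LHom.onTerm, hs]
      exact congrArg (fun g => Term.func g ts) hg

/-- Every formula lies in the range of any language map which hits a certain countable set of
symbols. -/
theorem exists_countable_symbols {L : Language.{u₁, v₁}} {α : Type w} {n : ℕ}
    (φ : L.BoundedFormula α n) :
    ∃ (F : ∀ n, Set (L.Functions n)) (R : ∀ n, Set (L.Relations n)),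
      (∀ n, (F n).Countable) ∧ (∀ n, (R n).Countable) ∧
      ∀ (K : Language.{0, 0}) (ι : K →ᴸ L),
        (∀ n, F n ⊆ Set.range fun f : K.Functions n => ι.onFunction f) →
        (∀ n, R n ⊆ Set.range fun r : K.Relations n => ι.onRelation r) →
        ∃ ψ : K.BoundedFormula α n, ι.onBoundedFormula ψ = φ := by
  induction φ with
  | falsum =>
    exact ⟨fun _ => ∅, fun _ => ∅, fun _ => Set.countable_empty, fun _ => Set.countable_empty,
      fun K ι _ _ => ⟨⊥, rfl⟩⟩
  | equal t₁ t₂ =>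
    obtain ⟨F₁, hF₁, h₁⟩ := exists_countable_functions t₁
    obtain ⟨F₂, hF₂, h₂⟩ := exists_countable_functions t₂
    refine ⟨fun n => F₁ n ∪ F₂ n, fun _ => ∅, fun n => (hF₁ n).union (hF₂ n),
      fun _ => Set.countable_empty, fun K ι hF _ => ?_⟩
    obtain ⟨s₁, rfl⟩ := h₁ K ι fun n => Set.subset_union_left.trans (hF n)
    obtain ⟨s₂, rfl⟩ := h₂ K ι fun n => Set.subset_union_right.trans (hF n)
    exact ⟨.equal s₁ s₂, rfl⟩
  | @rel m l r ts =>
    choose F hF hι using fun i => exists_countable_functions (ts i)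
    refine ⟨fun n => ⋃ i, F i n, fun n => {q | (⟨n, q⟩ : Σ n, L.Relations n) = ⟨l, r⟩},
      fun n => Set.countable_iUnion fun i => hF i n, fun n => Set.Subsingleton.countable ?_,
      fun K ι h h' => ?_⟩
    · intro g hg g' hg'
      exact eq_of_heq (Sigma.mk.inj (Eq.trans hg (Eq.symm hg'))).2
    · choose s hs using fun i => hι i K ι fun n =>
        (Set.subset_iUnion (fun i => F i n) i).trans (h n)
      obtain ⟨q, hq⟩ := h' l rfl
      refine ⟨.rel q s, ?_⟩
      obtain rfl : (fun i => ι.onTerm (s i)) = ts := funext hs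
      exact congrArg (fun q => BoundedFormula.rel q fun i => ι.onTerm (s i)) hq
  | imp _ _ ih₁ ih₂ =>
    obtain ⟨F₁, R₁, hF₁, hR₁, h₁⟩ := ih₁
    obtain ⟨F₂, R₂, hF₂, hR₂, h₂⟩ := ih₂
    refine ⟨fun n => F₁ n ∪ F₂ n, fun n => R₁ n ∪ R₂ n, fun n => (hF₁ n).union (hF₂ n),
      fun n => (hR₁ n).union (hR₂ n), fun K ι hF hR => ?_⟩
    obtain ⟨ψ₁, rfl⟩ := h₁ K ι (fun n => Set.subset_union_left.trans (hF n))
      fun n => Set.subset_union_left.trans (hR n)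
    obtain ⟨ψ₂, rfl⟩ := h₂ K ι (fun n => Set.subset_union_right.trans (hF n))
      fun n => Set.subset_union_right.trans (hR n)
    exact ⟨ψ₁.imp ψ₂, rfl⟩
  | all _ ih =>
    obtain ⟨F, R, hF, hR, h⟩ := ih
    refine ⟨F, R, hF, hR, fun K ι hF hR => ?_⟩
    obtain ⟨ψ, rfl⟩ := h K ι hF hR
    exact ⟨ψ.all, rfl⟩

/-- Countably many symbols of a language form a countable language in the lowest universe. -/
theorem exists_countable_sublanguage {L : Language.{u₁, v₁}} {F : ∀ n, Set (L.Functions n)}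
    {R : ∀ n, Set (L.Relations n)} (hF : ∀ n, (F n).Countable) (hR : ∀ n, (R n).Countable) :
    ∃ (K : Language.{0, 0}) (κ : K →ᴸ L), Countable K.Symbols ∧ κ.Injective ∧
      (∀ n, F n ⊆ Set.range fun f : K.Functions n => κ.onFunction f) ∧
      ∀ n, R n ⊆ Set.range fun r : K.Relations n => κ.onRelation r := by
  have := fun n => (hF n).to_subtype
  have := fun n => (hR n).to_subtype
  let K : Language.{0, 0} := ⟨fun n => Shrink.{0} (F n), fun n => Shrink.{0} (R n)⟩
  have hKF : ∀ n, Countable (K.Functions n) :=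
    fun n => (equivShrink.{0} (F n)).symm.injective.countable
  have hKR : ∀ n, Countable (K.Relations n) :=
    fun n => (equivShrink.{0} (R n)).symm.injective.countable
  let κ : K →ᴸ L :=
    { onFunction := fun n f => ((equivShrink.{0} (F n)).symm f).1
      onRelation := fun n r => ((equivShrink.{0} (R n)).symm r).1 }
  refine ⟨K, κ, ?_, ⟨fun {n} => ?_, fun {n} => ?_⟩, fun n f hf => ?_, fun n r hr => ?_⟩
  · unfold Language.Symbols
    infer_instance
  · exact Subtype.val_injective.comp (equivShrink.{0} (F n)).symm.injective
  · exact Subtype.val_injective.comp (equivShrink.{0} (R n)).symm.injective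
  · exact ⟨equivShrink.{0} (F n) ⟨f, hf⟩, by simp [κ]⟩
  · exact ⟨equivShrink.{0} (R n) ⟨r, hr⟩, by simp [κ]⟩

theorem sumMap_injective {K L : Language.{0, 0}} {K' : Language.{u₁, v₁}} {L' : Language.{u₂, v₂}}
    {κ : K →ᴸ K'} {ν : L →ᴸ L'} (hκ : κ.Injective) (hν : ν.Injective) :
    (κ.sumMap ν).Injective :=
  ⟨fun {n} => (hκ.onFunction (n := n)).sumMap hν.onFunction,
    fun {n} => (hκ.onRelation (n := n)).sumMap hν.onRelation⟩

theorem range_sumMap_supset {α β α' β' : Type*} {f : α → α'} {g : β → β'}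
    {s : Set (α' ⊕ β')}
    (hf : Sum.inl ⁻¹' s ⊆ Set.range f) (hg : Sum.inr ⁻¹' s ⊆ Set.range g) :
    s ⊆ Set.range (Sum.map f g) := by
  rintro (x | x) hx
  · obtain ⟨y, rfl⟩ := hf hx
    exact ⟨.inl y, rfl⟩
  · obtain ⟨y, rfl⟩ := hg hx
    exact ⟨.inr y, rfl⟩

end FirstOrder.Language.Interpolation

open FirstOrder.Language.Interpolation

/-- **Craig Interpolation Theorem for classical first-order logic.**
Let `L₀`, `La`, `Lb` be first-order languages and `L = L₀.sum (La.sum Lb)` their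
disjoint union, with canonical inclusions `i₀ : L₀ →ᴸ L`, `i₁ : L₀.sum La →ᴸ L`,
`i₂ : L₀.sum Lb →ᴸ L`.  If `A` is a sentence of `L₀.sum La`, `B` a sentence of
`L₀.sum Lb`, and every nonempty `L`-structure satisfying the translation of `A`
also satisfies the translation of `B`, then there is an interpolant sentence `I`
of the common language `L₀` such that every nonempty `L`-structure satisfying the
translation of `A` satisfies the translation of `I`, and every nonempty
`L`-structure satisfying the translation of `I` satisfies the translation of `B`. -/
theorem firstOrder_craig_interpolation (L₀ La Lb : Language)
    (A : (L₀.sum La).Sentence) (B : (L₀.sum Lb).Sentence)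
    (i₀ : L₀ →ᴸ L₀.sum (La.sum Lb))
    (i₁ : L₀.sum La →ᴸ L₀.sum (La.sum Lb))
    (i₂ : L₀.sum Lb →ᴸ L₀.sum (La.sum Lb))
    (h₀ : i₀ = LHom.sumInl)
    (h₁ : i₁ = (LHom.id L₀).sumMap LHom.sumInl)
    (h₂ : i₂ = (LHom.id L₀).sumMap LHom.sumInr)
    (hAB : ∀ (M : Type) [(L₀.sum (La.sum Lb)).Structure M] [Nonempty M],
      M ⊨ i₁.onSentence A → M ⊨ i₂.onSentence B) :
    ∃ I : L₀.Sentence,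
      (∀ (M : Type) [(L₀.sum (La.sum Lb)).Structure M] [Nonempty M],
        M ⊨ i₁.onSentence A → M ⊨ i₀.onSentence I) ∧
      (∀ (M : Type) [(L₀.sum (La.sum Lb)).Structure M] [Nonempty M],
        M ⊨ i₀.onSentence I → M ⊨ i₂.onSentence B) := by
  classical
  subst h₀ h₁ h₂
  obtain ⟨FA, RA, hFA, hRA, hA⟩ := exists_countable_symbols A
  obtain ⟨FB, RB, hFB, hRB, hB⟩ := exists_countable_symbols B
  obtain ⟨K₀, κ₀, _, hκ₀, hF₀, hR₀⟩ := exists_countable_sublanguage (L := L₀)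
    (F := fun n => Sum.inl ⁻¹' FA n ∪ Sum.inl ⁻¹' FB n)
    (R := fun n => Sum.inl ⁻¹' RA n ∪ Sum.inl ⁻¹' RB n)
    (fun n => ((hFA n).preimage Sum.inl_injective).union ((hFB n).preimage Sum.inl_injective))
    (fun n => ((hRA n).preimage Sum.inl_injective).union ((hRB n).preimage Sum.inl_injective))
  obtain ⟨Ka, κa, _, hκa, hFa, hRa⟩ := exists_countable_sublanguage (L := La)
    (F := fun n => Sum.inr ⁻¹' FA n) (R := fun n => Sum.inr ⁻¹' RA n)
    (fun n => (hFA n).preimage Sum.inr_injective) (fun n => (hRA n).preimage Sum.inr_injective)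
  obtain ⟨Kb, κb, _, hκb, hFb, hRb⟩ := exists_countable_sublanguage (L := Lb)
    (F := fun n => Sum.inr ⁻¹' FB n) (R := fun n => Sum.inr ⁻¹' RB n)
    (fun n => (hFB n).preimage Sum.inr_injective) (fun n => (hRB n).preimage Sum.inr_injective)
  obtain ⟨A', hA'⟩ := hA (K₀.sum Ka) (κ₀.sumMap κa)
    (fun n => range_sumMap_supset (Set.subset_union_left.trans (hF₀ n)) (hFa n))
    (fun n => range_sumMap_supset (Set.subset_union_left.trans (hR₀ n)) (hRa n))
  obtain ⟨B', hB'⟩ := hB (K₀.sum Kb) (κ₀.sumMap κb)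
    (fun n => range_sumMap_supset (Set.subset_union_right.trans (hF₀ n)) (hFb n))
    (fun n => range_sumMap_supset (Set.subset_union_right.trans (hR₀ n)) (hRb n))
  let κ : K₀.sum (Ka.sum Kb) →ᴸ L₀.sum (La.sum Lb) := κ₀.sumMap (κa.sumMap κb)
  have hκ : κ.Injective := sumMap_injective hκ₀ (sumMap_injective hκa hκb)
  have hcomm₁ : κ.onSentence (((LHom.id K₀).sumMap LHom.sumInl).onSentence A') =
      ((LHom.id L₀).sumMap LHom.sumInl : L₀.sum La →ᴸ L₀.sum (La.sum Lb)).onSentence A := by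
    subst hA'
    refine (congrFun (LHom.comp_onBoundedFormula _ _) A').symm.trans
      (Eq.trans ?_ (congrFun (LHom.comp_onBoundedFormula _ _) A'))
    congr 1
    exact LHom.funext (funext fun n => funext fun x => by cases x <;> rfl)
      (funext fun n => funext fun x => by cases x <;> rfl)
  have hcomm₂ : κ.onSentence (((LHom.id K₀).sumMap LHom.sumInr).onSentence B') =
      ((LHom.id L₀).sumMap LHom.sumInr : L₀.sum Lb →ᴸ L₀.sum (La.sum Lb)).onSentence B := by
    subst hB'
    refine (congrFun (LHom.comp_onBoundedFormula _ _) B').symm.trans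
      (Eq.trans ?_ (congrFun (LHom.comp_onBoundedFormula _ _) B'))
    congr 1
    exact LHom.funext (funext fun n => funext fun x => by cases x <;> rfl)
      (funext fun n => funext fun x => by cases x <;> rfl)
  have hcomm₀ (I : K₀.Sentence) : κ.onSentence (LHom.sumInl.onSentence I) =
      (LHom.sumInl : L₀ →ᴸ L₀.sum (La.sum Lb)).onSentence (κ₀.onSentence I) :=
    (congrFun (LHom.comp_onBoundedFormula _ _) I).symm.trans
      (congrFun (LHom.comp_onBoundedFormula LHom.sumInl κ₀) I)
  obtain ⟨I, hAI, hIB⟩ := exists_interpolant_of_countable A' B' fun M _ _ h => by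
    have : Inhabited M := Classical.inhabited_of_nonempty ‹_›
    let := κ.defaultExpansion M
    have := hκ.isExpansionOn_default M
    rw [← LHom.realize_onSentence M κ, hcomm₁] at h
    rw [← LHom.realize_onSentence M κ, hcomm₂]
    exact hAB M h
  refine ⟨κ₀.onSentence I, fun M _ _ h => ?_, fun M _ _ h => ?_⟩
  · let := κ.reduct M
    let := ((LHom.id K₀).sumMap LHom.sumInl : K₀.sum Ka →ᴸ K₀.sum (Ka.sum Kb)).reduct M
    let := (LHom.sumInl : K₀ →ᴸ K₀.sum (Ka.sum Kb)).reduct M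
    have : (LHom.sumInl : K₀ →ᴸ K₀.sum Ka).IsExpansionOn M := ⟨fun _ _ => rfl, fun _ _ => rfl⟩
    rw [← hcomm₁, LHom.realize_onSentence, LHom.realize_onSentence] at h
    rw [← hcomm₀, LHom.realize_onSentence, LHom.realize_onSentence]
    rw [← LHom.realize_onSentence M (LHom.sumInl : K₀ →ᴸ K₀.sum Ka)]
    exact hAI M h
  · let := κ.reduct M
    let := ((LHom.id K₀).sumMap LHom.sumInr : K₀.sum Kb →ᴸ K₀.sum (Ka.sum Kb)).reduct M
    let := (LHom.sumInl : K₀ →ᴸ K₀.sum (Ka.sum Kb)).reduct M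
    have : (LHom.sumInl : K₀ →ᴸ K₀.sum Kb).IsExpansionOn M := ⟨fun _ _ => rfl, fun _ _ => rfl⟩
    rw [← hcomm₂, LHom.realize_onSentence, LHom.realize_onSentence]
    rw [← hcomm₀, LHom.realize_onSentence, LHom.realize_onSentence] at h
    rw [← LHom.realize_onSentence M (LHom.sumInl : K₀ →ᴸ K₀.sum Kb)] at h
    exact hIB M h
end
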